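/- With αᵢ as before and the λ-bracket of RW(4,4), the following identity holds for the λ-bracket of α₅ with itself: [α₅_λ α₅] = λ₅ B_{λλ} C_{λ∂} α₅, where B_{λλ} = Σᵢ₌₁⁴ λᵢλ_{i+4} and C_{λ∂} = Σᵢ₌₁⁸ λᵢ∂_{σ(i)} is the pairing Σᵢ₌₁⁴(λᵢ∂_{i+4} + λ_{i+4}∂ᵢ). In particular [α₅_λ α₅] lies in F[λ]⊗RE(4,4). -/

import Mathlib

open scoped TensorProduct
open MvPolynomial

set_option synthInstance.maxHeartbeats 1000000
set_option maxHeartbeats 1000000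

noncomputable section

variable (F : Type) [Field F] [CharZero F]

/-- Even variables: `X (inl i) = ∂_{i+1}`, `X (inr i) = λ_{i+1}` (0-based). -/
abbrev PolyC := MvPolynomial (Fin 4 ⊕ Fin 4) F

/-- Odd variables: `inl i ↦ ∂_{i+5}`, `inr i ↦ λ_{i+5}` (0-based). -/
abbrev ExtC := ExteriorAlgebra F ((Fin 4 ⊕ Fin 4) → F)

/-- The supercommutative coefficient algebra `F[∂,λ] = F[∂₁,…,∂₄,λ₁,…,λ₄] ⊗
Λ(∂₅,…,∂₈,λ₅,…,λ₈)`, containing both `F[∂]` and the polynomial algebra in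
`λ`. -/
abbrev AC := ExtC F ⊗[F] PolyC F

/-- The variables `∂₁,…,∂₈` (0-based). -/
def delv (i : Fin 8) : AC F :=
  if h : (i : ℕ) < 4 then (1 : ExtC F) ⊗ₜ[F] (X (Sum.inl ⟨i, h⟩) : PolyC F)
  else (ExteriorAlgebra.ι F (Pi.single (Sum.inl ⟨(i : ℕ) - 4, by omega⟩) (1 : F)))
        ⊗ₜ[F] (1 : PolyC F)

/-- The variables `λ₁,…,λ₈` (0-based). -/
def lamv (i : Fin 8) : AC F :=
  if h : (i : ℕ) < 4 then (1 : ExtC F) ⊗ₜ[F] (X (Sum.inr ⟨i, h⟩) : PolyC F)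
  else (ExteriorAlgebra.ι F (Pi.single (Sum.inr ⟨(i : ℕ) - 4, by omega⟩) (1 : F)))
        ⊗ₜ[F] (1 : PolyC F)

/-- Parity of the index `i` (`true` = odd, for `i ∈ {5,…,8}`). -/
def pr8 (i : Fin 8) : Bool := decide (4 ≤ (i : ℕ))

/-- `(−1)^b`. -/
def sg (b : Bool) : ℤ := if b then -1 else 1

/-- `RW(4,4) ⊗ F[λ]`: the free module on the generators `a₁,…,a₈` with
coefficients in `F[∂,λ]`; elements are coefficient vectors `(c₁,…,c₈)`,
representing `Σᵢ cᵢ aᵢ` (coefficients written on the left). -/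
abbrev MC := Fin 8 → AC F

/-- The generators `a₁,…,a₈` (0-based; `a₁,…,a₄` even, `a₅,…,a₈` odd). -/
def av (i : Fin 8) : MC F := Pi.single i (1 : AC F)

/-- Right multiplication of an element of the free module by `∂ᵢ`
(Koszul signs from moving `∂ᵢ` past the generators `a_k`). -/
def rmulD (i : Fin 8) (v : MC F) : MC F :=
  fun k => sg (pr8 i && pr8 k) • (v k * delv F i)

/-- Right multiplication of an element of the free module by `λᵢ`. -/
def rmulL (i : Fin 8) (v : MC F) : MC F :=
  fun k => sg (pr8 i && pr8 k) • (v k * lamv F i)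

/-- The defining property of the `λ`-bracket of `RW(4,4)`:
`F`-bilinearity, the generator formula `[aᵢ_λ aⱼ] = (∂ᵢ+λᵢ)aⱼ + aᵢλⱼ`, and
the two sesquilinearity rules `[(∂ᵢa)_λ b] = −λᵢ[a_λ b]`,
`[a_λ (b∂ᵢ)] = [a_λ b](∂ᵢ+λᵢ)`.  These uniquely determine the bracket. -/
structure IsRWBracket (br : MC F →ₗ[F] MC F →ₗ[F] MC F) : Prop where
  gen_formula : ∀ i j : Fin 8,
    br (av F i) (av F j) =
      (delv F i + lamv F i) • av F j + sg (pr8 i && pr8 j) • (lamv F j • av F i)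
  sesq_left : ∀ (i : Fin 8) (u v : MC F),
    br (delv F i • u) v = -(lamv F i • br u v)
  sesq_right : ∀ (i : Fin 8) (u v : MC F),
    br u (rmulD F i v) = rmulD F i (br u v) + rmulL F i (br u v)

/-- `B_{λλ} = Σ_{i=1}^4 λᵢλ_{i+4}`. -/
def Bll : AC F := ∑ i : Fin 4, lamv F ⟨i, by omega⟩ * lamv F ⟨(i : ℕ) + 4, by omega⟩

/-- `C_{λ∂} = Σ_{i=1}^4 (λᵢ∂_{i+4} + λ_{i+4}∂ᵢ)`. -/
def Cld : AC F :=
  ∑ i : Fin 4, (lamv F ⟨i, by omega⟩ * delv F ⟨(i : ℕ) + 4, by omega⟩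
    + lamv F ⟨(i : ℕ) + 4, by omega⟩ * delv F ⟨i, by omega⟩)

/-- `C_{∂a} = Σ_{i=1}^4 (∂ᵢ a_{i+4} + ∂_{i+4} aᵢ)`. -/
def Cda : MC F :=
  ∑ i : Fin 4, (delv F ⟨i, by omega⟩ • av F ⟨(i : ℕ) + 4, by omega⟩
    + delv F ⟨(i : ℕ) + 4, by omega⟩ • av F ⟨i, by omega⟩)

end
noncomputable section
variable (F : Type) [Field F] [CharZero F]

/-- `ν₁,…,ν₄` (0-based): `ν₁ = ∂₆∂₇∂₈`, `ν₂ = −∂₅∂₇∂₈`, `ν₃ = ∂₅∂₆∂₈`,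
`ν₄ = −∂₅∂₆∂₇`. -/
def nuC : Fin 4 → AC F
  | 0 => delv F 5 * delv F 6 * delv F 7
  | 1 => -(delv F 4 * delv F 6 * delv F 7)
  | 2 => delv F 4 * delv F 5 * delv F 7
  | 3 => -(delv F 4 * delv F 5 * delv F 6)

/-- `ν` extended by `ν₅ = ⋯ = ν₈ = 0`. -/
def nuC8 (i : Fin 8) : AC F :=
  if h : (i : ℕ) < 4 then nuC F ⟨i, h⟩ else 0

/-- `B_{∂∂} = Σ_{i=1}^4 ∂ᵢ∂_{i+4}`. -/
def Bdd : AC F := ∑ i : Fin 4, delv F ⟨i, by omega⟩ * delv F ⟨(i : ℕ) + 4, by omega⟩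

/-- `B_{νa} = Σ_{i=1}^4 νᵢ a_{i+4}`. -/
def Bnua : MC F := ∑ i : Fin 4, nuC F i • av F ⟨(i : ℕ) + 4, by omega⟩

/-- `αᵢ = ∂ᵢ B_{∂∂} C_{∂a} − 2νᵢ C_{∂a} + ∂ᵢ B_{νa}` (0-based; in particular
`α₅ = alphC 4 = ∂₅(B_{∂∂}C_{∂a} + B_{νa})`). -/
def alphC (i : Fin 8) : MC F :=
  (delv F i * Bdd F) • Cda F - (2 : ℤ) • (nuC8 F i • Cda F) + delv F i • Bnua F

set_option linter.all false
theorem gen_even {A : Type*} [Ring A] {e b c t g h f Tl Tm : A}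
    (ee : e*e=0) (bb : b*b=0) (cc : c*c=0) (tt : t*t=0) (gg : g*g=0)
    (be : b*e = -(e*b)) (ce : c*e = -(e*c)) (te : t*e = -(e*t)) (ge : g*e = -(e*g)) (he : h*e = -(e*h))
    (cb : c*b = -(b*c)) (tb : t*b = -(b*t)) (gb : g*b = -(b*g)) (hb : h*b = -(b*h))
    (tc : t*c = -(c*t)) (gc : g*c = -(c*g)) (hc : h*c = -(c*h))
    (gt : g*t = -(t*g)) (ht : h*t = -(t*h)) (hg : h*g = -(g*h)) :
    e*b*c*(t*g*f) + Tl*t*(t*g*f) + e*b*h*(t*g*c + e*Tm)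
      = e*b*(c-2*b)*((t-e)*(g+b-c)*(f-h)) := by
  have L : ∀ {x y : A}, x*y = -(y*x) → ∀ z, x*(y*z) = -(y*(x*z)) := by
    intro x y H z; rw [← mul_assoc, H, neg_mul, mul_assoc]
  have Z : ∀ {x : A}, x*x = 0 → ∀ z, x*(x*z) = 0 := by
    intro x H z; rw [← mul_assoc, H, zero_mul]
  simp only [two_mul, mul_add, add_mul, mul_sub, sub_mul, mul_assoc, mul_neg, neg_mul, neg_neg,
    ee, bb, cc, tt, gg, be, ce, te, ge, he, cb, tb, gb, hb, tc, gc, hc, gt, ht, hg,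
    Z ee, Z bb, Z cc, Z tt, Z gg, L be, L ce, L te, L ge, L he, L cb, L tb, L gb, L hb, L tc, L gc,
    L hc, L gt, L ht, L hg, mul_zero, zero_mul, neg_zero, add_zero, zero_add, sub_zero, zero_sub]
  abel

theorem gen_odd {A : Type*} [Ring A] {e b c t g x y Tl Tm : A}
    (ee : e*e=0) (bb : b*b=0) (cc : c*c=0) (tt : t*t=0) (gg : g*g=0)
    (be : b*e = -(e*b)) (ce : c*e = -(e*c)) (te : t*e = -(e*t)) (ge : g*e = -(e*g))
    (cb : c*b = -(b*c)) (tb : t*b = -(b*t)) (gb : g*b = -(b*g))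
    (tc : t*c = -(c*t)) (gc : g*c = -(c*g)) (gt : g*t = -(t*g))
    (hx : ∀ z, x*z = z*x) :
    e*b*c*(t*g*y) + Tl*t*(t*g*y) - e*b*x*(t*g*c + e*Tm)
      = e*b*(c-2*b)*((t-e)*(g+b-c)*(y-x)) := by
  have L : ∀ {x y : A}, x*y = -(y*x) → ∀ z, x*(y*z) = -(y*(x*z)) := by
    intro x y H z; rw [← mul_assoc, H, neg_mul, mul_assoc]
  have Z : ∀ {x : A}, x*x = 0 → ∀ z, x*(x*z) = 0 := by
    intro x H z; rw [← mul_assoc, H, zero_mul]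
  have X : ∀ z w, x*(z*w) = z*(x*w) := by
    intro z w; rw [← mul_assoc, hx, mul_assoc]
  simp only [two_mul, mul_add, add_mul, mul_sub, sub_mul, mul_assoc, mul_neg, neg_mul, neg_neg,
    ee, bb, cc, tt, gg, be, ce, te, ge, cb, tb, gb, tc, gc, gt, hx e, hx b, hx c, hx t, hx g, 
    Z ee, Z bb, Z cc, Z tt, Z gg, L be, L ce, L te, L ge, L cb, L tb, L gb, L tc, L gc,
    L gt, X e, X b, X c, X t, X g, mul_zero, zero_mul, neg_zero, add_zero, zero_add, sub_zero, zero_sub]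

/-- the top-degree identity: `p = η`, `q = θ`, coefficients `x`, `y` central. -/
theorem gen_top {S A : Type*} [CommRing S] [Ring A] [Algebra S A]
    (e t p1 p2 p3 q1 q2 q3 : A) (x y : Fin 4 → S)
    (ee : e*e=0) (tt : t*t=0) (p11 : p1*p1=0) (p22 : p2*p2=0) (p33 : p3*p3=0)
    (q11 : q1*q1=0) (q22 : q2*q2=0) (q33 : q3*q3=0)
    (te : t*e = -(e*t)) (p1e : p1*e = -(e*p1)) (p2e : p2*e = -(e*p2)) (p3e : p3*e = -(e*p3))
    (q1e : q1*e = -(e*q1)) (q2e : q2*e = -(e*q2)) (q3e : q3*e = -(e*q3))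
    (p1t : p1*t = -(t*p1)) (p2t : p2*t = -(t*p2)) (p3t : p3*t = -(t*p3))
    (q1t : q1*t = -(t*q1)) (q2t : q2*t = -(t*q2)) (q3t : q3*t = -(t*q3))
    (p21 : p2*p1 = -(p1*p2)) (p31 : p3*p1 = -(p1*p3)) (p32 : p3*p2 = -(p2*p3))
    (q21 : q2*q1 = -(q1*q2)) (q31 : q3*q1 = -(q1*q3)) (q32 : q3*q2 = -(q2*q3))
    (r11 : q1*p1 = -(p1*q1)) (r12 : q1*p2 = -(p2*q1)) (r13 : q1*p3 = -(p3*q1))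
    (r21 : q2*p1 = -(p1*q2)) (r22 : q2*p2 = -(p2*q2)) (r23 : q2*p3 = -(p3*q2))
    (r31 : q3*p1 = -(p1*q3)) (r32 : q3*p2 = -(p2*q3)) (r33 : q3*p3 = -(p3*q3))
    (b c g : A) (hb : b = x 0 • e + x 1 • p1 + x 2 • p2 + x 3 • p3)
    (hg : g = y 0 • t + y 1 • q1 + y 2 • q2 + y 3 • q3)
    (hc : c = (x 0 • t + y 0 • e) + (x 1 • q1 + y 1 • p1) + (x 2 • q2 + y 2 • p2)
      + (x 3 • q3 + y 3 • p3)) :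
    e*b*c*(t*q1*q2*q3) + e*p1*p2*p3*t*(t*q1*q2*q3)
      - e*p1*p2*p3*(t*g*c + e*(t*q1*q2*q3))
      = e*b*(c-2*b)*((t-e)*(q1-p1)*(q2-p2)*(q3-p3)) := by
  have L : ∀ {x y : A}, x*y = -(y*x) → ∀ z, x*(y*z) = -(y*(x*z)) := by
    intro x y H z; rw [← mul_assoc, H, neg_mul, mul_assoc]
  have Z : ∀ {x : A}, x*x = 0 → ∀ z, x*(x*z) = 0 := by
    intro x H z; rw [← mul_assoc, H, zero_mul]
  subst hb hg hc
  simp only [two_mul, mul_add, add_mul, mul_sub, sub_mul, mul_assoc, mul_neg, neg_mul, neg_neg,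
    smul_mul_assoc, mul_smul_comm, smul_neg, smul_zero,
    ee, tt, p11, p22, p33, q11, q22, q33, te, p1e, p2e, p3e, q1e, q2e, q3e, p1t, p2t, p3t,
    q1t, q2t, q3t, p21, p31, p32, q21, q31, q32, r11, r12, r13, r21, r22, r23, r31, r32, r33,
    Z ee, Z tt, Z p11, Z p22, Z p33, Z q11, Z q22, Z q33, L te, L p1e, L p2e, L p3e, L q1e, L q2e,
    L q3e, L p1t, L p2t, L p3t, L q1t, L q2t, L q3t, L p21, L p31, L p32, L q21, L q31, L q32,
    L r11, L r12, L r13, L r21, L r22, L r23, L r31, L r32, L r33,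
    mul_zero, zero_mul, neg_zero, add_zero, zero_add, sub_zero, zero_sub]
  module

def BB {A : Type*} [Ring A] (v : Fin 8 → A) : A := v 0 * v 4 + v 1 * v 5 + v 2 * v 6 + v 3 * v 7

def CC {A : Type*} [Ring A] (u v : Fin 8 → A) : A :=
  (u 0 * v 4 + u 4 * v 0) + (u 1 * v 5 + u 5 * v 1) + (u 2 * v 6 + u 6 * v 2)
    + (u 3 * v 7 + u 7 * v 3)

def TT {A : Type*} [Ring A] (v : Fin 8 → A) : A := v 4 * v 5 * v 6 * v 7

def PP {A : Type*} [Ring A] (v : Fin 8 → A) : Fin 8 → A :=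
  ![v 4 * BB v * v 4, v 4 * BB v * v 5, v 4 * BB v * v 6, v 4 * BB v * v 7,
    v 4 * BB v * v 0 + TT v, v 4 * BB v * v 1, v 4 * BB v * v 2, v 4 * BB v * v 3]

theorem core {A : Type*} [Ring A] (l m : Fin 8 → A) (O : AddSubgroup A)
    (hl : ∀ i : Fin 8, (i : ℕ) < 4 → l i ∈ Subring.center A)
    (hm : ∀ i : Fin 8, (i : ℕ) < 4 → m i ∈ Subring.center A)
    (ol : ∀ i : Fin 8, 4 ≤ (i : ℕ) → l i ∈ O)
    (om : ∀ i : Fin 8, 4 ≤ (i : ℕ) → m i ∈ O)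
    (anti : ∀ a ∈ O, ∀ b ∈ O, a * b = -(b * a)) (sq : ∀ a ∈ O, a * a = 0)
    (sm : ∀ i : Fin 8, (i : ℕ) < 4 → ∀ a ∈ O, l i * a ∈ O ∧ m i * a ∈ O)
    (k : Fin 8) :
    l 4 * BB l * CC l m * PP m k + TT l * m 4 * PP m k
      + sg (pr8 k) • (PP l k * (m 4 * BB m * CC l m + l 4 * TT m))
    = l 4 * BB l * CC l (m - l) * PP (m - l) k := by
  have cl : ∀ i : Fin 8, (i : ℕ) < 4 → ∀ z, l i * z = z * l i := fun i hi z =>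
    ((Subring.mem_center_iff.1 (hl i hi)) z).symm
  have cm : ∀ i : Fin 8, (i : ℕ) < 4 → ∀ z, m i * z = z * m i := fun i hi z =>
    ((Subring.mem_center_iff.1 (hm i hi)) z).symm
  have oe := ol 4 (by decide)
  have ot := om 4 (by decide)
  have ob : BB l ∈ O := by
    unfold BB
    exact O.add_mem (O.add_mem (O.add_mem (sm 0 (by decide) _ (ol 4 (by decide))).1
      (sm 1 (by decide) _ (ol 5 (by decide))).1) (sm 2 (by decide) _ (ol 6 (by decide))).1)
      (sm 3 (by decide) _ (ol 7 (by decide))).1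
  have og : BB m ∈ O := by
    unfold BB
    exact O.add_mem (O.add_mem (O.add_mem (sm 0 (by decide) _ (om 4 (by decide))).2
      (sm 1 (by decide) _ (om 5 (by decide))).2) (sm 2 (by decide) _ (om 6 (by decide))).2)
      (sm 3 (by decide) _ (om 7 (by decide))).2
  have hCC : CC l m = (l 0 * m 4 + m 0 * l 4) + (l 1 * m 5 + m 1 * l 5) + (l 2 * m 6 + m 2 * l 6)
      + (l 3 * m 7 + m 3 * l 7) := by
    unfold CC
    rw [cm 0 (by decide), cm 1 (by decide), cm 2 (by decide), cm 3 (by decide)]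
  have oc : CC l m ∈ O := by
    rw [hCC]
    exact O.add_mem (O.add_mem (O.add_mem
      (O.add_mem (sm 0 (by decide) _ (om 4 (by decide))).1 (sm 0 (by decide) _ (ol 4 (by decide))).2)
      (O.add_mem (sm 1 (by decide) _ (om 5 (by decide))).1 (sm 1 (by decide) _ (ol 5 (by decide))).2))
      (O.add_mem (sm 2 (by decide) _ (om 6 (by decide))).1 (sm 2 (by decide) _ (ol 6 (by decide))).2))
      (O.add_mem (sm 3 (by decide) _ (om 7 (by decide))).1 (sm 3 (by decide) _ (ol 7 (by decide))).2)
  have hC : CC l (m - l) = CC l m - 2 * BB l := by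
    simp only [CC, BB, Pi.sub_apply, mul_sub]
    rw [← cl 0 (by decide) (l 4), ← cl 1 (by decide) (l 5), ← cl 2 (by decide) (l 6),
      ← cl 3 (by decide) (l 7), two_mul]
    abel
  have hB : BB (m - l) = BB m + BB l - CC l m := by
    rw [hCC]
    simp only [BB, Pi.sub_apply, mul_sub, sub_mul]
    abel
  have hT : TT (m - l) = (m 4 - l 4) * (m 5 - l 5) * (m 6 - l 6) * (m 7 - l 7) := rfl
  have evk : ∀ n : Fin 8, 4 ≤ (n : ℕ) → 
    l 4 * BB l * CC l m * (m 4 * BB m * m n) + TT l * m 4 * (m 4 * BB m * m n)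
      + l 4 * BB l * l n * (m 4 * BB m * CC l m + l 4 * TT m)
    = l 4 * BB l * CC l (m - l) * ((m - l) 4 * BB (m - l) * (m - l) n) := by
    intro n hn
    rw [hC, hB]
    have oh := ol n hn
    exact gen_even (sq _ oe) (sq _ ob) (sq _ oc) (sq _ ot) (sq _ og) (anti _ ob _ oe)
      (anti _ oc _ oe) (anti _ ot _ oe) (anti _ og _ oe) (anti _ oh _ oe)
      (anti _ oc _ ob) (anti _ ot _ ob) (anti _ og _ ob) (anti _ oh _ ob)
      (anti _ ot _ oc) (anti _ og _ oc) (anti _ oh _ oc) (anti _ og _ ot) (anti _ oh _ ot)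
      (anti _ oh _ og)
  have odk : ∀ n : Fin 8, (n : ℕ) < 4 → 
    l 4 * BB l * CC l m * (m 4 * BB m * m n) + TT l * m 4 * (m 4 * BB m * m n)
      - l 4 * BB l * l n * (m 4 * BB m * CC l m + l 4 * TT m)
    = l 4 * BB l * CC l (m - l) * ((m - l) 4 * BB (m - l) * (m - l) n) := by
    intro n hn
    rw [hC, hB]
    exact gen_odd (sq _ oe) (sq _ ob) (sq _ oc) (sq _ ot) (sq _ og) (anti _ ob _ oe)
      (anti _ oc _ oe) (anti _ ot _ oe) (anti _ og _ oe)
      (anti _ oc _ ob) (anti _ ot _ ob) (anti _ og _ ob)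
      (anti _ ot _ oc) (anti _ og _ oc) (anti _ og _ ot) (cl n hn)
  have top : l 4 * BB l * CC l m * TT m + TT l * m 4 * TT m
      - TT l * (m 4 * BB m * CC l m + l 4 * TT m)
      = l 4 * BB l * CC l (m - l) * TT (m - l) := by
    rw [hC, hT]
    have o5 := ol 5 (by decide)
    have o6 := ol 6 (by decide)
    have o7 := ol 7 (by decide)
    have u5 := om 5 (by decide)
    have u6 := om 6 (by decide)
    have u7 := om 7 (by decide)
    refine gen_top (S := Subring.center A) (l 4) (m 4) (l 5) (l 6) (l 7) (m 5) (m 6) (m 7)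
      ![⟨l 0, hl 0 (by decide)⟩, ⟨l 1, hl 1 (by decide)⟩, ⟨l 2, hl 2 (by decide)⟩,
        ⟨l 3, hl 3 (by decide)⟩]
      ![⟨m 0, hm 0 (by decide)⟩, ⟨m 1, hm 1 (by decide)⟩, ⟨m 2, hm 2 (by decide)⟩,
        ⟨m 3, hm 3 (by decide)⟩]
      ?_ ?_ ?_ ?_ ?_ ?_ ?_ ?_ ?_ ?_ ?_ ?_ ?_ ?_ ?_ ?_ ?_ ?_ ?_ ?_ ?_ ?_ ?_ ?_ ?_ ?_ ?_ ?_ ?_ ?_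
      ?_ ?_ ?_ ?_ ?_ ?_ _ _ _ rfl rfl hCC
    all_goals first
      | exact sq _ (by assumption)
      | exact anti _ (by assumption) _ (by assumption)
  fin_cases k
  · simpa [PP, sg, pr8] using evk 4 (by decide)
  · simpa [PP, sg, pr8] using evk 5 (by decide)
  · simpa [PP, sg, pr8] using evk 6 (by decide)
  · simpa [PP, sg, pr8] using evk 7 (by decide)
  · have h0 := odk 0 (by decide)
    have := congrArg₂ (· + ·) h0 top
    simp only [← mul_add] at this
    simp only [PP, sg, pr8]
    simp only [Fin.reduceFinMk, Matrix.cons_val]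
    rw [← this]
    simp [mul_add, add_mul]
    abel
  · simpa [PP, sg, pr8, sub_eq_add_neg] using odk 1 (by decide)
  · simpa [PP, sg, pr8, sub_eq_add_neg] using odk 2 (by decide)
  · simpa [PP, sg, pr8, sub_eq_add_neg] using odk 3 (by decide)

def oddS : Submodule F (AC F) :=
  LinearMap.range (TensorProduct.map (ExteriorAlgebra.ι F (M := (Fin 4 ⊕ Fin 4) → F))
    (LinearMap.id : PolyC F →ₗ[F] PolyC F))

theorem cent (p : PolyC F) : ((1 : ExtC F) ⊗ₜ[F] p : AC F) ∈ Subring.center (AC F) := by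
  rw [Subring.mem_center_iff]
  intro g
  induction g using TensorProduct.induction_on with
  | zero => simp
  | tmul a b => simp [Algebra.TensorProduct.tmul_mul_tmul, mul_comm]
  | add a b ha hb => rw [add_mul, mul_add, ha, hb]

theorem odd_smul (p : PolyC F) (a : AC F) (ha : a ∈ oddS F) :
    ((1 : ExtC F) ⊗ₜ[F] p : AC F) * a ∈ oddS F := by
  obtain ⟨z, rfl⟩ := ha
  induction z using TensorProduct.induction_on with
  | zero => simp
  | tmul v b => exact ⟨v ⊗ₜ (p * b), by simp [Algebra.TensorProduct.tmul_mul_tmul]⟩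
  | add a b ha hb => rw [map_add, mul_add]; exact (oddS F).add_mem ha hb

theorem odd_anti (a : AC F) (ha : a ∈ oddS F) (b : AC F) (hb : b ∈ oddS F) :
    a * b = -(b * a) := by
  obtain ⟨z, rfl⟩ := ha
  obtain ⟨w, rfl⟩ := hb
  induction z using TensorProduct.induction_on with
  | zero => simp
  | add a b ha hb => rw [map_add, mul_add, add_mul, ha, hb]; abel
  | tmul v p =>
    induction w using TensorProduct.induction_on with
    | zero => simp
    | add a b ha hb => rw [map_add, mul_add, add_mul, ha, hb]; abel
    | tmul w q =>
      simp only [TensorProduct.map_tmul, LinearMap.id_coe, id_eq,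
        Algebra.TensorProduct.tmul_mul_tmul]
      rw [mul_comm q p, ← TensorProduct.neg_tmul]
      congr 1
      exact eq_neg_of_add_eq_zero_left (ExteriorAlgebra.ι_add_mul_swap v w)

theorem odd_sq (a : AC F) (ha : a ∈ oddS F) : a * a = 0 := by
  have h := odd_anti F a ha a ha
  have h2 : (2 : F) • (a * a) = 0 := by
    rw [two_smul]; nth_rewrite 1 [h]; simp
  exact (smul_eq_zero.1 h2).resolve_left two_ne_zero

theorem del_cent (i : Fin 8) (h : (i : ℕ) < 4) :
    ∃ p : PolyC F, delv F i = (1 : ExtC F) ⊗ₜ[F] p := by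
  unfold delv; rw [dif_pos h]; exact ⟨_, rfl⟩

theorem lam_cent (i : Fin 8) (h : (i : ℕ) < 4) :
    ∃ p : PolyC F, lamv F i = (1 : ExtC F) ⊗ₜ[F] p := by
  unfold lamv; rw [dif_pos h]; exact ⟨_, rfl⟩

theorem del_odd (i : Fin 8) (h : 4 ≤ (i : ℕ)) : delv F i ∈ oddS F := by
  unfold delv; rw [dif_neg (by omega)]; exact ⟨_ ⊗ₜ 1, rfl⟩

theorem lam_odd (i : Fin 8) (h : 4 ≤ (i : ℕ)) : lamv F i ∈ oddS F := by
  unfold lamv; rw [dif_neg (by omega)]; exact ⟨_ ⊗ₜ 1, rfl⟩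

/-- `∂ + λ`. -/
def muv : Fin 8 → AC F := delv F + lamv F

theorem coreAC (k : Fin 8) :
    lamv F 4 * BB (lamv F) * CC (lamv F) (muv F) * PP (muv F) k
      + TT (lamv F) * muv F 4 * PP (muv F) k
      + sg (pr8 k) • (PP (lamv F) k *
        (muv F 4 * BB (muv F) * CC (lamv F) (muv F) + lamv F 4 * TT (muv F)))
    = lamv F 4 * BB (lamv F) * CC (lamv F) (delv F) * PP (delv F) k := by
  have hd : delv F = muv F - lamv F := by unfold muv; abel
  have key : ∀ i : Fin 8, (i : ℕ) < 4 → ∃ p : PolyC F, muv F i = (1 : ExtC F) ⊗ₜ[F] p := by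
    intro i hi
    obtain ⟨p, hp⟩ := del_cent F i hi
    obtain ⟨q, hq⟩ := lam_cent F i hi
    exact ⟨p + q, by rw [TensorProduct.tmul_add, ← hp, ← hq]; rfl⟩
  rw [hd]
  refine core (lamv F) (muv F) (oddS F).toAddSubgroup ?_ ?_ ?_ ?_ ?_ ?_ ?_ k
  · intro i hi
    obtain ⟨q, hq⟩ := lam_cent F i hi
    rw [hq]; exact cent F q
  · intro i hi
    obtain ⟨q, hq⟩ := key i hi
    rw [hq]; exact cent F q
  · exact fun i hi => lam_odd F i hi
  · exact fun i hi => (oddS F).add_mem (del_odd F i hi) (lam_odd F i hi)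
  · exact odd_anti F
  · exact odd_sq F
  · intro i hi a ha
    obtain ⟨p, hp⟩ := lam_cent F i hi
    obtain ⟨q, hq⟩ := key i hi
    rw [hp, hq]
    exact ⟨odd_smul F p a ha, odd_smul F q a ha⟩

theorem aux_nil {A : Type*} [Ring A] (a b c : A) (h : a * a = 0) : a * -(a * b * c) = 0 := by
  rw [mul_neg, ← mul_assoc, ← mul_assoc, h, zero_mul, zero_mul, neg_zero]

theorem aux_comm {A : Type*} [Ring A] (a b c : A) (h : a * b = -(b * a)) (h' : a * c = -(c * a)) :
    a * (b * c) = b * c * a := by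
  rw [← mul_assoc, h, neg_mul, mul_assoc, h', mul_neg, neg_neg, mul_assoc]

theorem aux_E {A : Type*} [Ring A] (l m : Fin 8 → A)
    (h : ∀ n, l n * (m 4 * BB m) = m 4 * BB m * l n) :
    m 4 * BB m * CC l m + l 4 * TT m = ∑ n, l n * PP m n := by
  have h' : ∀ n w, l n * (m 4 * BB m * w) = m 4 * BB m * (l n * w) := by
    intro n w; rw [← mul_assoc, h, mul_assoc]
  rw [Fin.sum_univ_eight]
  simp only [PP, Matrix.cons_val, mul_add (l 4), h', CC]
  simp only [mul_add]
  abel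

theorem lam_comm (n : Fin 8) :
    lamv F n * (muv F 4 * BB (muv F)) = muv F 4 * BB (muv F) * lamv F n := by
  by_cases hn : (n : ℕ) < 4
  · obtain ⟨q, hq⟩ := lam_cent F n hn
    rw [hq]
    exact (Subring.mem_center_iff.1 (cent F q) _).symm
  · have key : ∀ i : Fin 8, (i : ℕ) < 4 → ∀ a ∈ oddS F, muv F i * a ∈ oddS F := by
      intro i hi a ha
      obtain ⟨p, hp⟩ := del_cent F i hi
      obtain ⟨q, hq⟩ := lam_cent F i hi
      have : muv F i = (1 : ExtC F) ⊗ₜ[F] (p + q) := by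
        rw [TensorProduct.tmul_add, ← hp, ← hq]; rfl
      rw [this]; exact odd_smul F _ a ha
    have om : ∀ i : Fin 8, 4 ≤ (i : ℕ) → muv F i ∈ oddS F :=
      fun i hi => (oddS F).add_mem (del_odd F i hi) (lam_odd F i hi)
    have og : BB (muv F) ∈ oddS F := by
      unfold BB
      exact Submodule.add_mem _ (Submodule.add_mem _ (Submodule.add_mem _
        (key 0 (by decide) _ (om 4 (by decide))) (key 1 (by decide) _ (om 5 (by decide))))
        (key 2 (by decide) _ (om 6 (by decide)))) (key 3 (by decide) _ (om 7 (by decide)))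
    have ol := lam_odd F n (by omega)
    exact aux_comm _ _ _ (odd_anti F _ ol _ (om 4 (by decide))) (odd_anti F _ ol _ og)

theorem alph_eq : alphC F 4 = PP (delv F) := by
  have sq4 := odd_sq F _ (del_odd F 4 (by decide))
  have h1 : nuC8 F 4 = 0 := by unfold nuC8; rw [dif_neg (by decide)]
  have hB : Bdd F = BB (delv F) := by
    simp only [Bdd, Fin.sum_univ_four]; rfl
  have h2 : delv F 4 • Bnua F = TT (delv F) • av F 4 := by
    have e0 : delv F 4 * nuC F 0 = TT (delv F) := by simp only [nuC, TT, mul_assoc]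
    have e1 : delv F 4 * nuC F 1 = 0 := by
      exact aux_nil _ _ _ sq4
    have e2 : delv F 4 * nuC F 2 = 0 := by
      simp only [nuC, ← mul_assoc, sq4, zero_mul]
    have e3 : delv F 4 * nuC F 3 = 0 := by
      exact aux_nil _ _ _ sq4
    have z : ∀ w : MC F, (0 : AC F) • w = 0 := fun w => by funext j; exact zero_mul _
    simp only [Bnua, Fin.sum_univ_four, smul_add, smul_smul, e0, e1, e2, e3, z, add_zero]
    rfl
  have hC : Cda F = ![delv F 4, delv F 5, delv F 6, delv F 7,
      delv F 0, delv F 1, delv F 2, delv F 3] := by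
    simp only [Cda, Fin.sum_univ_four, av]
    funext k
    fin_cases k <;> simp [Pi.single_apply]
  rw [alphC, h1, h2, hB, hC]
  funext k
  fin_cases k <;> simp [PP, av, Pi.single_apply]

theorem br_left (br : MC F →ₗ[F] MC F →ₗ[F] MC F) (hbr : IsRWBracket F br) (v : MC F) :
    br (alphC F 4) v = (lamv F 4 * BB (lamv F)) • (
      (lamv F 0 • br (av F 4) v + lamv F 4 • br (av F 0) v)
      + (lamv F 1 • br (av F 5) v + lamv F 5 • br (av F 1) v)
      + (lamv F 2 • br (av F 6) v + lamv F 6 • br (av F 2) v)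
      + (lamv F 3 • br (av F 7) v + lamv F 7 • br (av F 3) v))
      + TT (lamv F) • br (av F 4) v := by
  have h2 : alphC F 4 = (delv F 4 * BB (delv F)) • (
      (delv F 0 • av F 4 + delv F 4 • av F 0)
      + (delv F 1 • av F 5 + delv F 5 • av F 1)
      + (delv F 2 • av F 6 + delv F 6 • av F 2)
      + (delv F 3 • av F 7 + delv F 7 • av F 3))
      + TT (delv F) • av F 4 := by
    rw [alph_eq]
    funext k
    fin_cases k <;> simp [PP, av, Pi.single_apply]
  have hT : br (TT (delv F) • av F 4) v = TT (lamv F) • br (av F 4) v := by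
    have ms : ∀ (a b : AC F) (w : MC F), (a * b) • w = a • b • w := fun a b w => mul_smul a b w
    unfold TT
    rw [ms, ms, ms, ms, ms, ms]
    simp only [hbr.sesq_left, smul_neg, neg_neg]
  rw [h2, map_add, LinearMap.add_apply, hT]
  congr 1
  simp only [BB, mul_smul, add_smul, smul_add, mul_add, map_add, LinearMap.add_apply,
    hbr.sesq_left, smul_neg, neg_neg]

theorem sg_sq (b : Bool) : sg b * sg b = 1 := by cases b <;> rfl

theorem br_right_step (br : MC F →ₗ[F] MC F →ₗ[F] MC F) (hbr : IsRWBracket F br) (u : MC F)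
    (c : AC F) (i n k : Fin 8) :
    br u ((c * delv F i) • av F n) k
      = (sg (pr8 i && pr8 n) * sg (pr8 i && pr8 k)) • (br u (c • av F n) k * muv F i) := by
  have h : (c * delv F i) • av F n = sg (pr8 i && pr8 n) • rmulD F i (c • av F n) := by
    funext j
    by_cases hj : j = n
    · subst hj
      cases hb : (pr8 i && pr8 j) <;> simp [rmulD, av, sg, hb]
    · simp [rmulD, av, hj]
  rw [h, map_zsmul, hbr.sesq_right]
  simp only [Pi.smul_apply, Pi.add_apply, rmulD, rmulL, muv, mul_add, smul_add, smul_smul]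

theorem br_right (br : MC F →ₗ[F] MC F →ₗ[F] MC F) (hbr : IsRWBracket F br) (u : MC F)
    (n k : Fin 8) :
    br u (PP (delv F) n • av F n) k
      = sg (!(pr8 n) && pr8 k) • (br u (av F n) k * PP (muv F) n) := by
  have st := br_right_step F br hbr u
  have s1 : ∀ i n k, br u (delv F i • av F n) k
      = (sg (pr8 i && pr8 n) * sg (pr8 i && pr8 k)) • (br u (av F n) k * muv F i) := by
    intro i n k
    have := st 1 i n k
    rwa [one_mul, one_smul] at this
  have w4 : ∀ a b c d n k, br u ((delv F a * delv F b * delv F c * delv F d) • av F n) k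
      = ((sg (pr8 d && pr8 n) * sg (pr8 d && pr8 k)) * ((sg (pr8 c && pr8 n) * sg (pr8 c && pr8 k))
        * ((sg (pr8 b && pr8 n) * sg (pr8 b && pr8 k)) *
          (sg (pr8 a && pr8 n) * sg (pr8 a && pr8 k))))) •
        (br u (av F n) k * (muv F a * muv F b * muv F c * muv F d)) := by
    intro a b c d n k
    rw [st, st, st, s1]
    simp only [smul_mul_assoc, smul_smul, mul_assoc]
  have ex : ∀ v : Fin 8 → AC F, ∀ j, v 4 * BB v * v j = v 4 * v 0 * v 4 * v j
      + v 4 * v 1 * v 5 * v j + v 4 * v 2 * v 6 * v j + v 4 * v 3 * v 7 * v j := by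
    intro v j
    simp only [BB, mul_add, add_mul, mul_assoc]
  have p0 : pr8 0 = false := rfl
  have p1 : pr8 1 = false := rfl
  have p2 : pr8 2 = false := rfl
  have p3 : pr8 3 = false := rfl
  have p4 : pr8 4 = true := rfl
  have p5 : pr8 5 = true := rfl
  have p6 : pr8 6 = true := rfl
  have p7 : pr8 7 = true := rfl
  fin_cases n <;>
    simp only [Fin.reduceFinMk, Fin.zero_eta, Fin.mk_one, PP, Matrix.cons_val, ex, TT, add_smul, map_add, Pi.add_apply, w4,
      p0, p1, p2, p3, p4, p5, p6, p7] <;>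
    cases pr8 k <;> simp [sg, mul_add]

theorem br_av (br : MC F →ₗ[F] MC F →ₗ[F] MC F) (hbr : IsRWBracket F br) (i k : Fin 8) :
    br (av F i) (alphC F 4) k = muv F i * PP (muv F) k
      + if k = i then sg (pr8 k) • (muv F 4 * BB (muv F) * CC (lamv F) (muv F)
          + lamv F 4 * TT (muv F)) else 0 := by
  have h : alphC F 4 = ∑ n, PP (delv F) n • av F n := by
    rw [alph_eq]; funext k
    simp [av, Pi.single_apply, Finset.sum_apply]
  have hE : muv F 4 * BB (muv F) * CC (lamv F) (muv F) + lamv F 4 * TT (muv F)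
      = ∑ n, lamv F n * PP (muv F) n := by
    exact aux_E _ _ (lam_comm F)
  have t : ∀ n, br (av F i) (PP (delv F) n • av F n) k
      = (if n = k then muv F i * PP (muv F) k else 0)
        + if k = i then sg (pr8 k) • (lamv F n * PP (muv F) n) else 0 := by
    intro n
    rw [br_right F br hbr, hbr.gen_formula]
    by_cases h1 : n = k <;> by_cases h2 : k = i
    · subst h1 h2
      cases hp : pr8 n <;> simp [av, sg, muv, hp, add_mul]
    · subst h1
      cases hp : pr8 n <;> cases hq : pr8 i <;> simp [av, sg, muv, hp, hq, h2]
    · subst h2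
      cases hp : pr8 n <;> cases hq : pr8 k <;> simp [av, sg, hp, hq, h1, Ne.symm h1]
      exact neg_mul (lamv F n) _
    · simp [av, h1, h2, Ne.symm h1]
  rw [h, map_sum, Finset.sum_apply, Finset.sum_congr rfl (fun n _ => t n),
    Finset.sum_add_distrib, hE]
  by_cases h2 : k = i <;> simp [h2, Finset.smul_sum]

theorem aux_fin {A : Type*} [Ring A] (l m : Fin 8 → A) (Q E : A) (k : Fin 8) :
    l 4 * BB l * (
      (l 0 * (m 4 * Q + if k = 4 then sg (pr8 k) • E else 0)
        + l 4 * (m 0 * Q + if k = 0 then sg (pr8 k) • E else 0))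
      + (l 1 * (m 5 * Q + if k = 5 then sg (pr8 k) • E else 0)
        + l 5 * (m 1 * Q + if k = 1 then sg (pr8 k) • E else 0))
      + (l 2 * (m 6 * Q + if k = 6 then sg (pr8 k) • E else 0)
        + l 6 * (m 2 * Q + if k = 2 then sg (pr8 k) • E else 0))
      + (l 3 * (m 7 * Q + if k = 7 then sg (pr8 k) • E else 0)
        + l 7 * (m 3 * Q + if k = 3 then sg (pr8 k) • E else 0)))
      + TT l * (m 4 * Q + if k = 4 then sg (pr8 k) • E else 0)
    = l 4 * BB l * CC l m * Q + TT l * m 4 * Q + sg (pr8 k) • (PP l k * E) := by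
  have hc : l 4 * BB l * CC l m * Q = l 4 * BB l * ((l 0 * (m 4 * Q) + l 4 * (m 0 * Q))
      + (l 1 * (m 5 * Q) + l 5 * (m 1 * Q)) + (l 2 * (m 6 * Q) + l 6 * (m 2 * Q))
      + (l 3 * (m 7 * Q) + l 7 * (m 3 * Q))) := by
    simp only [CC, mul_assoc, add_mul]
  rw [hc]
  fin_cases k <;>
    simp [PP, sg, pr8, mul_add, add_mul, mul_assoc] <;> abel

theorem main_coord (br : MC F →ₗ[F] MC F →ₗ[F] MC F) (hbr : IsRWBracket F br) (k : Fin 8) :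
    br (alphC F 4) (alphC F 4) k
      = lamv F 4 * BB (lamv F) * CC (lamv F) (delv F) * PP (delv F) k := by
  rw [← coreAC, br_left F br hbr]
  simp only [Pi.add_apply, Pi.smul_apply, smul_eq_mul, br_av F br hbr]
  generalize muv F 4 * BB (muv F) * CC (lamv F) (muv F) + lamv F 4 * TT (muv F) = E
  exact aux_fin (lamv F) (muv F) (PP (muv F) k) E k

/-- `[α₅ λ α₅] = λ₅ B_{λλ} C_{λ∂} α₅`; in particular
`[α₅ λ α₅]` lies in `F[λ] ⊗ RE(4,4)`, the `F[∂,λ]`-submodule generated by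
`α₁,…,α₈`. -/
theorem stmt17 (br : MC F →ₗ[F] MC F →ₗ[F] MC F) (hbr : IsRWBracket F br) :
    br (alphC F 4) (alphC F 4) = (lamv F 4 * Bll F * Cld F) • alphC F 4 ∧
    br (alphC F 4) (alphC F 4) ∈
      Submodule.span (AC F) (Set.range (alphC F)) := by
  have hB : Bll F = BB (lamv F) := by
    simp only [Bll, Fin.sum_univ_four]; rfl
  have hC : Cld F = CC (lamv F) (delv F) := by
    simp only [Cld, Fin.sum_univ_four]; rfl
  have h : br (alphC F 4) (alphC F 4) = (lamv F 4 * Bll F * Cld F) • alphC F 4 := by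
    funext k
    rw [main_coord F br hbr, hB, hC, Pi.smul_apply, alph_eq, smul_eq_mul]
  refine ⟨h, ?_⟩
  rw [h]
  exact Submodule.smul_mem _ _ (Submodule.subset_span ⟨4, rfl⟩)

end
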